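/- There exists an absolute constant C > 0 such that the following holds. Let 0 < ε < 1/2 and let t, n be positive integers with n > ε^{-Ct}. Then every 2-colouring of the edges of the complete graph K_n with red and blue, in which every vertex has at least εn neighbours in red and at least εn neighbours in blue, contains a t-locally-unavoidable pattern. -/

import Mathlib

open Finset

/-- A 2-colouring `c` (with `true` = red, `false` = blue) of a complete graph on `V`
contains an induced copy of `K_{t,t}` in colour `col`. -/
def HasInducedKtt {V : Type*} [DecidableEq V] (c : V → V → Bool) (t : ℕ) (col : Bool) : Prop :=
  ∃ S T : Finset V, Disjoint S T ∧ S.card = t ∧ T.card = t ∧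
    (∀ u ∈ S, ∀ v ∈ T, c u v = col) ∧
    (∀ u ∈ S, ∀ v ∈ S, u ≠ v → c u v = !col) ∧
    (∀ u ∈ T, ∀ v ∈ T, u ≠ v → c u v = !col)

/-- A 2-colouring `c` (with `true` = red, `false` = blue) contains a member of the class
`P_m` on some `4m` vertices: four pairwise disjoint sets `V₁, V₂, V₃, V₄` of size `m` each
such that all edges inside `V₁ ∪ V₂` are red, all edges inside `V₃ ∪ V₄` are blue, all
edges between `V₁` and `V₃` and between `V₂` and `V₄` are red, and all edges between `V₁`
and `V₄` and between `V₂` and `V₃` are blue. -/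
def HasPpattern {V : Type*} [DecidableEq V] (c : V → V → Bool) (m : ℕ) : Prop :=
  ∃ V₁ V₂ V₃ V₄ : Finset V,
    Disjoint V₁ V₂ ∧ Disjoint V₁ V₃ ∧ Disjoint V₁ V₄ ∧
    Disjoint V₂ V₃ ∧ Disjoint V₂ V₄ ∧ Disjoint V₃ V₄ ∧
    V₁.card = m ∧ V₂.card = m ∧ V₃.card = m ∧ V₄.card = m ∧
    (∀ u ∈ V₁ ∪ V₂, ∀ v ∈ V₁ ∪ V₂, u ≠ v → c u v = true) ∧
    (∀ u ∈ V₃ ∪ V₄, ∀ v ∈ V₃ ∪ V₄, u ≠ v → c u v = false) ∧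
    (∀ u ∈ V₁, ∀ v ∈ V₃, c u v = true) ∧
    (∀ u ∈ V₂, ∀ v ∈ V₄, c u v = true) ∧
    (∀ u ∈ V₁, ∀ v ∈ V₄, c u v = false) ∧
    (∀ u ∈ V₂, ∀ v ∈ V₃, c u v = false)

/-- A 2-colouring contains a `t`-locally-unavoidable pattern: either an induced copy of
`K_{t,t}` in one of the colours, or a member of the class `P_t`. -/
def HasLocallyUnavoidable {V : Type*} [DecidableEq V] (c : V → V → Bool) (t : ℕ) : Prop :=
  (∃ col, HasInducedKtt c t col) ∨ HasPpattern c t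

/-- Ramsey: a set of size `2^(a+b)` contains a red `a`-clique or a blue `b`-clique. -/
theorem ramsey_aux {V : Type*} [DecidableEq V] (c : V → V → Bool) (hc : ∀ u v, c u v = c v u)
    (N : ℕ) : ∀ (a b : ℕ), a + b = N → ∀ A : Finset V, 2 ^ N ≤ A.card →
      (∃ S ⊆ A, S.card = a ∧ ∀ u ∈ S, ∀ v ∈ S, u ≠ v → c u v = true) ∨
      (∃ S ⊆ A, S.card = b ∧ ∀ u ∈ S, ∀ v ∈ S, u ≠ v → c u v = false) := by
  induction N with
  | zero =>
    intro a b hab A hA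
    left
    exact ⟨∅, by simp, by simp; omega, by simp⟩
  | succ N ih =>
    intro a b hab A hA
    rcases Nat.eq_zero_or_pos a with ha | ha
    · left
      exact ⟨∅, by simp, by simp [ha], by simp⟩
    rcases Nat.eq_zero_or_pos b with hb | hb
    · right
      exact ⟨∅, by simp, by simp [hb], by simp⟩
    have hpos : 0 < 2 ^ N := by positivity
    have hne : A.Nonempty := by
      rw [← Finset.card_pos]; rw [pow_succ] at hA; omega
    obtain ⟨x, hx⟩ := hne
    have h1 := Finset.card_erase_of_mem hx
    have h2 := Finset.card_filter_add_card_filter_not (s := A.erase x) (fun y => c x y = true)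
    rw [pow_succ] at hA
    by_cases hr : 2 ^ N ≤ ((A.erase x).filter (fun y => c x y = true)).card
    · rcases ih (a - 1) b (by omega) _ hr with ⟨S, hS, hSc, hSm⟩ | ⟨S, hS, hSc, hSm⟩
      · left
        have hxS : x ∉ S := by
          intro h
          have := hS h
          simp at this
        refine ⟨insert x S, ?_, ?_, ?_⟩
        · intro y hy
          rcases Finset.mem_insert.1 hy with rfl | hy
          · exact hx
          · have := hS hy
            simp at this
            exact this.1.2
        · rw [Finset.card_insert_of_notMem hxS]; omega
        · intro u hu v hv huv
          rcases Finset.mem_insert.1 hu with rfl | hu'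
          · rcases Finset.mem_insert.1 hv with rfl | hv
            · exact absurd rfl huv
            · have := hS hv
              simp at this
              exact this.2
          · rcases Finset.mem_insert.1 hv with rfl | hv
            · have := hS hu'
              simp at this
              rw [hc]; exact this.2
            · exact hSm u hu' v hv huv
      · right
        refine ⟨S, fun y hy => ?_, hSc, hSm⟩
        have := hS hy
        simp at this
        exact this.1.2
    · have hb' : 2 ^ N ≤ ((A.erase x).filter (fun y => ¬ c x y = true)).card := by omega
      rcases ih a (b - 1) (by omega) _ hb' with ⟨S, hS, hSc, hSm⟩ | ⟨S, hS, hSc, hSm⟩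
      · left
        refine ⟨S, fun y hy => ?_, hSc, hSm⟩
        have := hS hy
        simp at this
        exact this.1.2
      · right
        have hxS : x ∉ S := by
          intro h
          have := hS h
          simp at this
        refine ⟨insert x S, ?_, ?_, ?_⟩
        · intro y hy
          rcases Finset.mem_insert.1 hy with rfl | hy
          · exact hx
          · have := hS hy
            simp at this
            exact this.1.2
        · rw [Finset.card_insert_of_notMem hxS]; omega
        · intro u hu v hv huv
          rcases Finset.mem_insert.1 hu with rfl | hu'
          · rcases Finset.mem_insert.1 hv with rfl | hv
            · exact absurd rfl huv
            · have := hS hv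
              simp at this
              exact this.2
          · rcases Finset.mem_insert.1 hv with rfl | hv
            · have := hS hu'
              simp at this
              rw [hc]; exact this.2
            · exact hSm u hu' v hv huv

theorem ramsey_mono {V : Type*} [DecidableEq V] (c : V → V → Bool) (hc : ∀ u v, c u v = c v u)
    (t : ℕ) (A : Finset V) (hA : 4 ^ t ≤ A.card) :
      ∃ S ⊆ A, S.card = t ∧ ∃ col, ∀ u ∈ S, ∀ v ∈ S, u ≠ v → c u v = col := by
  have h4 : (4 : ℕ) ^ t = 2 ^ (t + t) := by
    rw [← two_mul, pow_mul]; norm_num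
  rcases ramsey_aux c hc (t + t) t t rfl A (by omega) with ⟨S, hS, hSc, hSm⟩ | ⟨S, hS, hSc, hSm⟩
  · exact ⟨S, hS, hSc, true, hSm⟩
  · exact ⟨S, hS, hSc, false, hSm⟩

/-- Two huge sets contain monochromatic cliques, monochromatic to each other. -/
theorem pair_mono {V : Type*} [DecidableEq V] (c : V → V → Bool) (hc : ∀ u v, c u v = c v u)
    (t : ℕ) (A B : Finset V) (hA : 16 ^ t ≤ A.card) (hB : 16 ^ t ≤ B.card) :
      ∃ S ⊆ A, ∃ T ⊆ B, S.card = t ∧ T.card = t ∧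
        (∃ col, ∀ u ∈ S, ∀ v ∈ S, u ≠ v → c u v = col) ∧
        (∃ col, ∀ u ∈ T, ∀ v ∈ T, u ≠ v → c u v = col) ∧
        (∃ col, ∀ u ∈ S, ∀ v ∈ T, c u v = col) := by
  have h16 : (16 : ℕ) ^ t = 4 ^ (2 * t) := by rw [pow_mul]; norm_num
  have h16' : (16 : ℕ) ^ t = 2 ^ (2 * t) * 4 ^ t := by rw [pow_mul, ← mul_pow]; norm_num
  obtain ⟨S, hS, hSc, a, hSm⟩ := ramsey_mono c hc (2 * t) A (by omega)
  -- pigeonhole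
  obtain ⟨P, hP, hPc⟩ := Finset.exists_le_card_fiber_of_mul_le_card_of_maps_to
    (s := B) (t := S.powerset) (f := fun b => S.filter (fun u => c u b = true)) (n := 4 ^ t)
    (fun b _ => by simp) ⟨∅, by simp⟩ (by rw [Finset.card_powerset, hSc]; omega)
  obtain ⟨T, hT, hTc, b, hTm⟩ := ramsey_mono c hc t _ hPc
  have hPS : P ⊆ S := by simpa using hP
  have hTP : ∀ v ∈ T, S.filter (fun u => c u v = true) = P := by
    intro v hv
    have := hT hv
    simp at this
    exact this.2
  have hTB : T ⊆ B := fun v hv => by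
    have := hT hv
    simp at this
    exact this.1
  have hcard := Finset.card_sdiff_add_card_eq_card hPS
  by_cases h : t ≤ P.card
  · obtain ⟨S', hS', hS'c⟩ := Finset.exists_subset_card_eq h
    refine ⟨S', (hS'.trans hPS).trans hS, T, hTB, hS'c, hTc,
      ⟨a, fun u hu v hv => hSm u (hPS (hS' hu)) v (hPS (hS' hv))⟩, ⟨b, hTm⟩, true, ?_⟩
    intro u hu v hv
    have : u ∈ S.filter (fun u => c u v = true) := by rw [hTP v hv]; exact hS' hu
    simp at this
    exact this.2
  · have h' : t ≤ (S \ P).card := by omega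
    obtain ⟨S', hS', hS'c⟩ := Finset.exists_subset_card_eq h'
    have hsub : S' ⊆ S := hS'.trans Finset.sdiff_subset
    refine ⟨S', hsub.trans hS, T, hTB, hS'c, hTc,
      ⟨a, fun u hu v hv => hSm u (hsub hu) v (hsub hv)⟩, ⟨b, hTm⟩, false, ?_⟩
    intro u hu v hv
    have h1 : u ∉ S.filter (fun u => c u v = true) := by
      rw [hTP v hv]; exact (Finset.mem_sdiff.1 (hS' hu)).2
    simp at h1
    exact h1 (hsub hu)

theorem card_words {V : Type*} [Fintype V] [DecidableEq V] (q : ℕ) (S S' : Finset V) :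
    ((univ : Finset ((Fin q → V) × (Fin q → V))).filter
      (fun w => (∀ i, w.1 i ∈ S) ∧ ∀ i, w.2 i ∈ S')).card = S.card ^ q * S'.card ^ q := by
  have : ((univ : Finset ((Fin q → V) × (Fin q → V))).filter
      (fun w => (∀ i, w.1 i ∈ S) ∧ ∀ i, w.2 i ∈ S')) =
      (Fintype.piFinset fun _ => S) ×ˢ (Fintype.piFinset fun _ => S') := by
    ext w
    simp [Fintype.mem_piFinset]
  rw [this, Finset.card_product]
  simp

/-- Common neighbourhood. -/
def cmn {V : Type*} [Fintype V] [DecidableEq V] (N M : V → Finset V) (S T : Finset V) :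
    Finset V := univ.filter (fun y => (∀ u ∈ S, y ∈ N u) ∧ ∀ k ∈ T, y ∈ M k)

theorem mem_cmn {V : Type*} [Fintype V] [DecidableEq V] (N M : V → Finset V) (S T : Finset V)
    (y : V) : y ∈ cmn N M S T ↔ (∀ u ∈ S, y ∈ N u) ∧ ∀ k ∈ T, y ∈ M k := by
  simp [cmn]

theorem dcount {A B : Type*} (s : Finset A) (t : Finset B) (r : A → B → Prop)
    [∀ a b, Decidable (r a b)] :
    ∑ a ∈ s, (t.filter (fun b => r a b)).card = ∑ b ∈ t, (s.filter (fun a => r a b)).card := by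
  simp only [Finset.card_filter]
  exact Finset.sum_comm

theorem drc {V : Type*} [Fintype V] [DecidableEq V] (X Y : V → Finset V) (n t q m a : ℕ)
    (hn : Fintype.card V = n) (G : Finset (V × V))
    (hG : ∀ p ∈ G, a ≤ (X p.1 ∩ Y p.2).card ∧ a ≤ (Y p.1 ∩ X p.2).card)
    (hineq : n ^ 2 * (n ^ t * n ^ t * (m ^ q * n ^ q)) + (n ^ q * n ^ q) * (m * n)
      < G.card * (a ^ q * a ^ q)) :
    ∃ U K : Finset V, m ≤ U.card ∧ m ≤ K.card ∧
      ∀ S ⊆ U, ∀ T ⊆ K, S.card = t → T.card = t →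
        m ≤ (cmn X Y S T).card ∧ m ≤ (cmn Y X S T).card := by
  classical
  let W := (Fin q → V) × (Fin q → V)
  obtain ⟨U, hUm⟩ : ∃ U : W → Finset V, ∀ w u, u ∈ U w ↔
      ((∀ i, w.1 i ∈ X u) ∧ ∀ i, w.2 i ∈ Y u) :=
    ⟨fun w => univ.filter (fun u => (∀ i, w.1 i ∈ X u) ∧ ∀ i, w.2 i ∈ Y u), by simp⟩
  obtain ⟨K, hKm⟩ : ∃ K : W → Finset V, ∀ w u, u ∈ K w ↔
      ((∀ i, w.1 i ∈ Y u) ∧ ∀ i, w.2 i ∈ X u) :=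
    ⟨fun w => univ.filter (fun u => (∀ i, w.1 i ∈ Y u) ∧ ∀ i, w.2 i ∈ X u), by simp⟩
  let Z : Finset (Finset V × Finset V) :=
    ((powersetCard t univ) ×ˢ (powersetCard t univ)).filter
      (fun p => (cmn X Y p.1 p.2).card < m ∨ (cmn Y X p.1 p.2).card < m)
  let bad : W → Finset (Finset V × Finset V) := fun w =>
    Z.filter (fun p => p.1 ⊆ U w ∧ p.2 ⊆ K w)
  have hWcard : (univ : Finset W).card = n ^ q * n ^ q := by
    simp [W, hn]
  have hZcard : Z.card ≤ n ^ t * n ^ t := by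
    refine (Finset.card_filter_le _ _).trans ?_
    rw [Finset.card_product, Finset.card_powersetCard, Finset.card_univ, hn]
    exact Nat.mul_le_mul (Nat.choose_le_pow n t) (Nat.choose_le_pow n t)
  have hbad : ∑ w, (bad w).card ≤ n ^ t * n ^ t * (m ^ q * n ^ q) := by
    have e : ∑ w, (bad w).card
        = ∑ p ∈ Z, ((univ : Finset W).filter (fun w => p.1 ⊆ U w ∧ p.2 ⊆ K w)).card :=
      dcount (univ : Finset W) Z (fun w p => p.1 ⊆ U w ∧ p.2 ⊆ K w)
    rw [e]
    refine (Finset.sum_le_card_nsmul Z _ (m ^ q * n ^ q) ?_).trans ?_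
    · intro p hp
      have hsub : ((univ : Finset W).filter (fun w => p.1 ⊆ U w ∧ p.2 ⊆ K w)) ⊆
          (univ : Finset W).filter (fun w => (∀ i, w.1 i ∈ cmn X Y p.1 p.2) ∧
            ∀ i, w.2 i ∈ cmn Y X p.1 p.2) := by
        intro w hw
        obtain ⟨h1, h2⟩ := (Finset.mem_filter.1 hw).2
        have h1' : ∀ u ∈ p.1, (∀ i, w.1 i ∈ X u) ∧ ∀ i, w.2 i ∈ Y u := fun u hu =>
          (hUm w u).1 (h1 hu)
        have h2' : ∀ u ∈ p.2, (∀ i, w.1 i ∈ Y u) ∧ ∀ i, w.2 i ∈ X u := fun u hu =>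
          (hKm w u).1 (h2 hu)
        refine Finset.mem_filter.2 ⟨Finset.mem_univ _, fun i => ?_, fun i => ?_⟩
        · exact (mem_cmn _ _ _ _ _).2 ⟨fun u hu => (h1' u hu).1 i,
            fun u hu => (h2' u hu).1 i⟩
        · exact (mem_cmn _ _ _ _ _).2 ⟨fun u hu => (h1' u hu).2 i,
            fun u hu => (h2' u hu).2 i⟩
      refine (Finset.card_le_card hsub).trans ?_
      rw [card_words]
      have b1 : (cmn X Y p.1 p.2).card ≤ n := by rw [← hn]; exact Finset.card_le_univ _
      have b2 : (cmn Y X p.1 p.2).card ≤ n := by rw [← hn]; exact Finset.card_le_univ _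
      rcases (Finset.mem_filter.1 hp).2 with h | h
      · exact Nat.mul_le_mul (Nat.pow_le_pow_left h.le q) (Nat.pow_le_pow_left b2 q)
      · rw [mul_comm]
        exact Nat.mul_le_mul (Nat.pow_le_pow_left h.le q) (Nat.pow_le_pow_left b1 q)
    · rw [smul_eq_mul]
      exact Nat.mul_le_mul_right _ hZcard
  have hgood : G.card * (a ^ q * a ^ q) ≤ ∑ w, (U w).card * (K w).card := by
    have e : ∑ w, (G.filter (fun p => p.1 ∈ U w ∧ p.2 ∈ K w)).card
        = ∑ p ∈ G, ((univ : Finset W).filter (fun w => p.1 ∈ U w ∧ p.2 ∈ K w)).card :=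
      dcount (univ : Finset W) G (fun w p => p.1 ∈ U w ∧ p.2 ∈ K w)
    have l1 : ∑ w, (G.filter (fun p => p.1 ∈ U w ∧ p.2 ∈ K w)).card
        ≤ ∑ w, (U w).card * (K w).card := by
      refine Finset.sum_le_sum fun w _ => ?_
      rw [← Finset.card_product]
      refine Finset.card_le_card fun p hp => ?_
      exact Finset.mem_product.2 (Finset.mem_filter.1 hp).2
    refine le_trans ?_ l1
    rw [e, ← smul_eq_mul]
    refine Finset.card_nsmul_le_sum G _ _ fun p hp => ?_
    have hsub : (univ : Finset W).filter (fun w => (∀ i, w.1 i ∈ X p.1 ∩ Y p.2) ∧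
            ∀ i, w.2 i ∈ Y p.1 ∩ X p.2) ⊆
            ((univ : Finset W).filter (fun w => p.1 ∈ U w ∧ p.2 ∈ K w)) := by
      intro w hw
      obtain ⟨h1, h2⟩ := (Finset.mem_filter.1 hw).2
      refine Finset.mem_filter.2 ⟨Finset.mem_univ _, ?_, ?_⟩
      · exact (hUm _ _).2 ⟨fun i => (Finset.mem_inter.1 (h1 i)).1,
          fun i => (Finset.mem_inter.1 (h2 i)).1⟩
      · exact (hKm _ _).2 ⟨fun i => (Finset.mem_inter.1 (h1 i)).2,
          fun i => (Finset.mem_inter.1 (h2 i)).2⟩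
    refine le_trans ?_ (Finset.card_le_card hsub)
    rw [card_words]
    exact Nat.mul_le_mul (Nat.pow_le_pow_left (hG p hp).1 q) (Nat.pow_le_pow_left (hG p hp).2 q)
  have hlt : ∑ w : W, (n ^ 2 * (bad w).card + m * n) < ∑ w, (U w).card * (K w).card := by
    rw [Finset.sum_add_distrib, ← Finset.mul_sum, Finset.sum_const, hWcard, smul_eq_mul]
    refine lt_of_le_of_lt ?_ (lt_of_lt_of_le hineq hgood)
    exact Nat.add_le_add_right (Nat.mul_le_mul_left _ hbad) _
  obtain ⟨w, -, hw⟩ := Finset.exists_lt_of_sum_lt hlt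
  have hU : (U w).card ≤ n := by rw [← hn]; exact Finset.card_le_univ _
  have hK : (K w).card ≤ n := by rw [← hn]; exact Finset.card_le_univ _
  have hb0 : (bad w).card = 0 := by
    by_contra h
    have : 1 ≤ (bad w).card := Nat.one_le_iff_ne_zero.2 h
    have := Nat.mul_le_mul hU hK
    nlinarith
  refine ⟨U w, K w, ?_, ?_, ?_⟩
  · by_contra h
    push Not at h
    have := Nat.mul_le_mul h.le hK
    omega
  · by_contra h
    push Not at h
    have := Nat.mul_le_mul hU h.le
    rw [mul_comm n m] at this
    omega
  · intro S hS T hT hSc hTc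
    by_contra h
    have hmem : (S, T) ∈ bad w := by
      refine Finset.mem_filter.2 ⟨Finset.mem_filter.2 ⟨?_, ?_⟩, hS, hT⟩
      · simp [Finset.mem_powersetCard, hSc, hTc]
      · simp only
        by_contra h'
        push Not at h'
        exact h h'
    rw [Finset.card_eq_zero] at hb0
    rw [hb0] at hmem
    simp at hmem

/-- A set of `s` vertices with the top values of `f`. -/
theorem exists_top {V : Type*} [Fintype V] [DecidableEq V] (f : V → ℕ) (s : ℕ) :
    s ≤ Fintype.card V → ∃ T : Finset V, T.card = s ∧ ∀ u ∈ T, ∀ k ∉ T, f k ≤ f u := by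
  induction s with
  | zero => intro _; exact ⟨∅, by simp, by simp⟩
  | succ s ih =>
    intro hs
    obtain ⟨T, hT, hTt⟩ := ih (by omega)
    have hne : (univ \ T).Nonempty := by
      rw [← Finset.card_pos, Finset.card_sdiff_of_subset (Finset.subset_univ _), Finset.card_univ]
      omega
    obtain ⟨x, hx, hxm⟩ := Finset.exists_max_image (univ \ T) f hne
    have hxT : x ∉ T := by simpa using hx
    refine ⟨insert x T, by rw [Finset.card_insert_of_notMem hxT, hT], ?_⟩
    intro u hu k hk
    simp only [Finset.mem_insert, not_or] at hk
    rcases Finset.mem_insert.1 hu with rfl | hu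
    · exact hxm k (by simpa using hk.2)
    · exact hTt u hu k hk.2

/-- Neighbourhood of `v` in colour `col`. -/
def nbh {n : ℕ} (c : Fin n → Fin n → Bool) (col : Bool) (v : Fin n) : Finset (Fin n) :=
  univ.filter fun u => u ≠ v ∧ c v u = col

theorem swap_card {n : ℕ} (c : Fin n → Fin n → Bool) (u k : Fin n)
    (h : (nbh c true k).card ≤ (nbh c true u).card) :
    (nbh c false u ∩ nbh c true k).card ≤ (nbh c true u ∩ nbh c false k).card + 1 := by
  have h1 : (nbh c false u ∩ nbh c true k).card + (nbh c true u ∩ nbh c true k).card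
      ≤ (nbh c true k).card := by
    rw [← Finset.card_union_of_disjoint]
    · apply Finset.card_le_card
      intro y
      simp only [Finset.mem_union, Finset.mem_inter]
      tauto
    · rw [Finset.disjoint_left]
      intro y hy hy'
      simp only [nbh, Finset.mem_inter, Finset.mem_filter, Finset.mem_univ, true_and] at hy hy'
      simp_all
  have h2 : (nbh c true u).card ≤
      (nbh c true u ∩ nbh c true k).card + (nbh c true u ∩ nbh c false k).card + 1 := by
    have hsub : nbh c true u ⊆
        ((nbh c true u ∩ nbh c true k) ∪ (nbh c true u ∩ nbh c false k)) ∪ {k} := by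
      intro y hy
      simp only [nbh, Finset.mem_inter, Finset.mem_filter, Finset.mem_univ, true_and,
        Finset.mem_union, Finset.mem_singleton] at hy ⊢
      by_cases hyk : y = k
      · simp [hyk]
      · cases hcy : c k y <;> simp_all
    have a1 := Finset.card_le_card hsub
    have a2 := Finset.card_union_le ((nbh c true u ∩ nbh c true k) ∪ (nbh c true u ∩ nbh c false k)) {k}
    have a3 := Finset.card_union_le (nbh c true u ∩ nbh c true k) (nbh c true u ∩ nbh c false k)
    simp only [Finset.card_singleton] at a2
    omega
  omega

theorem many_pairs {n : ℕ} (c : Fin n → Fin n → Bool) (hc : ∀ u v, c u v = c v u) (ε : ℝ)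
    (hε : 0 < ε) (hε2 : ε < 1 / 2) (hn : 4 ≤ ε ^ 2 * n)
    (hdeg : ∀ v col, ε * n ≤ ((nbh c col v).card : ℝ)) (a : ℕ) (ha : (a : ℝ) ≤ ε ^ 2 * n / 4) :
    ∃ G : Finset (Fin n × Fin n), a * a ≤ G.card ∧
      ∀ p ∈ G, a ≤ (nbh c false p.1 ∩ nbh c true p.2).card ∧
        a ≤ (nbh c true p.1 ∩ nbh c false p.2).card := by
  have hnR : (0 : ℝ) ≤ n := Nat.cast_nonneg n
  have hε1 : ε ^ 2 ≤ 1 := by nlinarith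
  have han : a ≤ n := by
    have : (a : ℝ) ≤ n := by nlinarith
    exact_mod_cast this
  obtain ⟨T, hT, hTt⟩ := exists_top (fun v => (nbh c true v).card) a (by simpa using han)
  let F : Fin n → Finset (Fin n) := fun u =>
    univ.filter (fun k => ε ^ 2 * n / 2 ≤ ((nbh c false u ∩ nbh c true k).card : ℝ))
  have hF : ∀ u, ε ^ 2 * n / 2 ≤ ((F u).card : ℝ) := by
    intro u
    have e : ∑ k : Fin n, (nbh c false u ∩ nbh c true k).card
        = ∑ y ∈ nbh c false u, (nbh c true y).card := by
      have := dcount (univ : Finset (Fin n)) (nbh c false u) (fun k y => y ∈ nbh c true k)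
      refine Eq.trans (Finset.sum_congr rfl fun k _ => ?_)
        (this.trans (Finset.sum_congr rfl fun y _ => ?_))
      · congr 1
      · congr 1; ext k
        simp only [nbh, Finset.mem_filter, Finset.mem_univ, true_and]
        rw [hc k y, ne_comm]
    have l1 : (ε * n) * (ε * n) ≤ ((∑ y ∈ nbh c false u, (nbh c true y).card : ℕ) : ℝ) := by
      push_cast
      have := Finset.card_nsmul_le_sum (nbh c false u) (fun y => ((nbh c true y).card : ℝ)) (ε * n)
        (fun y _ => hdeg y true)
      rw [nsmul_eq_mul] at this
      refine le_trans ?_ this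
      exact mul_le_mul_of_nonneg_right (hdeg u false) (by positivity)
    have l2 : ((∑ k : Fin n, (nbh c false u ∩ nbh c true k).card : ℕ) : ℝ)
        ≤ (F u).card * n + n * (ε ^ 2 * n / 2) := by
      push_cast
      rw [← Finset.sum_filter_add_sum_filter_not univ
        (fun k => ε ^ 2 * n / 2 ≤ ((nbh c false u ∩ nbh c true k).card : ℝ))]
      refine add_le_add ?_ ?_
      · have := Finset.sum_le_card_nsmul (F u)
          (fun k => ((nbh c false u ∩ nbh c true k).card : ℝ)) n (fun k _ => by
            have := Finset.card_le_univ (nbh c false u ∩ nbh c true k)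
            rw [Fintype.card_fin] at this
            exact_mod_cast this)
        rw [nsmul_eq_mul] at this
        exact this
      · have := Finset.sum_le_card_nsmul (univ.filter
          (fun k => ¬ ε ^ 2 * n / 2 ≤ ((nbh c false u ∩ nbh c true k).card : ℝ)))
          (fun k => ((nbh c false u ∩ nbh c true k).card : ℝ)) (ε ^ 2 * n / 2) (fun k hk => by
            exact (not_le.1 (Finset.mem_filter.1 hk).2).le)
        rw [nsmul_eq_mul] at this
        refine this.trans (mul_le_mul_of_nonneg_right ?_ (by positivity))
        have := Finset.card_le_univ (univ.filter
          (fun k => ¬ ε ^ 2 * n / 2 ≤ ((nbh c false u ∩ nbh c true k).card : ℝ)))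
        rw [Fintype.card_fin] at this
        exact_mod_cast this
    rw [e] at l2
    have l3 := l1.trans l2
    have hnpos : (0 : ℝ) < n := by
      rcases hnR.eq_or_lt with h | h
      · rw [← h] at hn; norm_num at hn
      · exact h
    have : (n : ℝ) * (ε ^ 2 * n / 2) ≤ n * (F u).card := by nlinarith
    exact le_of_mul_le_mul_left this hnpos
  refine ⟨(T ×ˢ univ).filter (fun p => p.2 ∈ F p.1 \ T), ?_, ?_⟩
  · have e : ((T ×ˢ univ).filter (fun p : Fin n × Fin n => p.2 ∈ F p.1 \ T))
        = (T.sigma (fun u => F u \ T)).map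
          (Equiv.sigmaEquivProd (Fin n) (Fin n)).toEmbedding := by
      ext ⟨u, k⟩
      simp
    rw [e, Finset.card_map, Finset.card_sigma, ← smul_eq_mul]
    rw [← hT, hT]
    nth_rewrite 1 [← hT]
    refine Finset.card_nsmul_le_sum T _ _ fun u _ => ?_
    have h1 : (2 * a : ℕ) ≤ (F u).card := by
      have := hF u
      have h2 : ((2 * a : ℕ) : ℝ) ≤ (F u).card := by push_cast; linarith
      exact_mod_cast h2
    have := Finset.le_card_sdiff T (F u)
    omega
  · rintro ⟨u, k⟩ hp
    simp only [Finset.mem_filter, Finset.mem_product, Finset.mem_sdiff] at hp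
    obtain ⟨⟨hu, -⟩, hk, hkT⟩ := hp
    have h1 : ε ^ 2 * n / 2 ≤ ((nbh c false u ∩ nbh c true k).card : ℝ) :=
      (Finset.mem_filter.1 hk).2
    have h2 := swap_card c u k (hTt u hu k hkT)
    have h2' : ((nbh c false u ∩ nbh c true k).card : ℝ)
        ≤ (nbh c true u ∩ nbh c false k).card + 1 := by exact_mod_cast h2
    constructor
    · have : (a : ℝ) ≤ (nbh c false u ∩ nbh c true k).card := by linarith
      exact_mod_cast this
    · have : (a : ℝ) ≤ (nbh c true u ∩ nbh c false k).card := by linarith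
      exact_mod_cast this

/-- From an alternating four-cycle blow-up to a pattern. -/
theorem finish {V : Type*} [DecidableEq V] (c : V → V → Bool) (hc : ∀ u v, c u v = c v u) (t : ℕ)
    (U K Y L : Finset V) (hU : U.card = t) (hK : K.card = t) (hY : Y.card = t) (hL : L.card = t)
    (dUK : Disjoint U K) (dUY : Disjoint U Y) (dUL : Disjoint U L)
    (dKY : Disjoint K Y) (dKL : Disjoint K L) (dYL : Disjoint Y L)
    (mU : ∃ col, ∀ u ∈ U, ∀ v ∈ U, u ≠ v → c u v = col)
    (mK : ∃ col, ∀ u ∈ K, ∀ v ∈ K, u ≠ v → c u v = col)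
    (mY : ∃ col, ∀ u ∈ Y, ∀ v ∈ Y, u ≠ v → c u v = col)
    (mL : ∃ col, ∀ u ∈ L, ∀ v ∈ L, u ≠ v → c u v = col)
    (mUK : ∃ col, ∀ u ∈ U, ∀ v ∈ K, c u v = col)
    (mYL : ∃ col, ∀ u ∈ Y, ∀ v ∈ L, c u v = col)
    (hUY : ∀ u ∈ U, ∀ v ∈ Y, c u v = false)
    (hKY : ∀ u ∈ K, ∀ v ∈ Y, c u v = true)
    (hUL : ∀ u ∈ U, ∀ v ∈ L, c u v = true)
    (hKL : ∀ u ∈ K, ∀ v ∈ L, c u v = false) : HasLocallyUnavoidable c t := by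
  have union_mono : ∀ (col : Bool) (A B : Finset V),
      (∀ u ∈ A, ∀ v ∈ A, u ≠ v → c u v = col) → (∀ u ∈ B, ∀ v ∈ B, u ≠ v → c u v = col) →
      (∀ u ∈ A, ∀ v ∈ B, c u v = col) →
      (∀ u ∈ A ∪ B, ∀ v ∈ A ∪ B, u ≠ v → c u v = col) := by
    intro col A B hA hB hAB u hu v hv huv
    rcases Finset.mem_union.1 hu with hu | hu <;> rcases Finset.mem_union.1 hv with hv | hv
    · exact hA u hu v hv huv
    · exact hAB u hu v hv
    · rw [hc]; exact hAB v hv u hu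
    · exact hB u hu v hv huv
  have sw : ∀ (col : Bool) (A B : Finset V),
      (∀ u ∈ A, ∀ v ∈ B, c u v = col) → (∀ u ∈ B, ∀ v ∈ A, c u v = col) := by
    intro col A B h u hu v hv
    rw [hc]; exact h v hv u hu
  obtain ⟨a, mU⟩ := mU
  obtain ⟨b, mK⟩ := mK
  obtain ⟨d, mY⟩ := mY
  obtain ⟨e, mL⟩ := mL
  obtain ⟨f, mUK⟩ := mUK
  obtain ⟨g, mYL⟩ := mYL
  cases a
  · cases e
    · exact Or.inl ⟨true, U, L, dUL, hU, hL, hUL, mU, mL⟩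
    cases b
    swap
    · exact Or.inl ⟨false, K, L, dKL, hK, hL, hKL, mK, mL⟩
    cases d
    · exact Or.inl ⟨true, K, Y, dKY, hK, hY, hKY, mK, mY⟩
    cases f
    swap
    · exact Or.inl ⟨true, U, K, dUK, hU, hK, mUK, mU, mK⟩
    cases g
    · exact Or.inl ⟨false, Y, L, dYL, hY, hL, mYL, mY, mL⟩
    exact Or.inr ⟨Y, L, K, U, dYL, dKY.symm, dUY.symm, dKL.symm, dUL.symm, dUK.symm,
      hY, hL, hK, hU, union_mono _ _ _ mY mL mYL, union_mono _ _ _ mK mU (sw _ _ _ mUK),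
      sw _ _ _ hKY, sw _ _ _ hUL, sw _ _ _ hUY, sw _ _ _ hKL⟩
  · cases d
    swap
    · exact Or.inl ⟨false, U, Y, dUY, hU, hY, hUY, mU, mY⟩
    cases b
    · exact Or.inl ⟨true, K, Y, dKY, hK, hY, hKY, mK, mY⟩
    cases e
    swap
    · exact Or.inl ⟨false, K, L, dKL, hK, hL, hKL, mK, mL⟩
    cases f
    · exact Or.inl ⟨false, U, K, dUK, hU, hK, mUK, mU, mK⟩
    cases g
    swap
    · exact Or.inl ⟨true, Y, L, dYL, hY, hL, mYL, mY, mL⟩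
    exact Or.inr ⟨U, K, L, Y, dUK, dUL, dUY, dKL, dKY, dYL.symm,
      hU, hK, hL, hY, union_mono _ _ _ mU mK mUK, union_mono _ _ _ mL mY (sw _ _ _ mYL),
      hUL, hKY, hUY, hKL⟩

/-- The numerical inequality. -/
theorem numeric (ε : ℝ) (t n a : ℕ) (hε : 0 < ε) (hε2 : ε < 1 / 2) (ht : 0 < t)
    (hn : (ε⁻¹) ^ (60 * t) < (n : ℝ)) (ha : ε ^ 5 * n ≤ (a : ℝ)) :
    n ^ 2 * (n ^ t * n ^ t * ((16 ^ t) ^ (4 * t) * n ^ (4 * t)))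
      + (n ^ (4 * t) * n ^ (4 * t)) * (16 ^ t * n)
      < (a * a) * (a ^ (4 * t) * a ^ (4 * t)) := by
  obtain ⟨X, hX⟩ : ∃ X : ℝ, X = ε⁻¹ := ⟨_, rfl⟩
  have hX2 : 2 ≤ X := by
    rw [hX, le_inv_comm₀ (by norm_num) hε]; linarith
  have hXε : X * ε = 1 := by rw [hX]; field_simp
  rw [← hX] at hn
  have hX1 : 1 ≤ X := by linarith
  have hX0 : 0 < X := by linarith
  have hn0 : (0 : ℝ) < n := lt_trans (by positivity) hn
  have han : (n : ℝ) ≤ X ^ 5 * a := by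
    have : X ^ 5 * (ε ^ 5 * n) ≤ X ^ 5 * a := by gcongr
    rwa [← mul_assoc, ← mul_pow, hXε, one_pow, one_mul] at this
  have h16 : (16 : ℝ) ^ t ≤ X ^ (4 * t) := by
    rw [pow_mul]
    gcongr
    calc (16 : ℝ) = 2 ^ 4 := by norm_num
      _ ≤ X ^ 4 := by gcongr
  have h2 : (2 : ℝ) ≤ X ^ t := hX2.trans (le_self_pow₀ hX1 ht.ne')
  have mono : ∀ {i : ℕ}, i ≤ 60 * t → X ^ i ≤ (n : ℝ) := fun h =>
    (pow_le_pow_right₀ hX1 h).trans hn.le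
  -- target in reals
  have key : 2 * (X ^ (5 * (8 * t + 2)) * (n ^ (6 * t + 2) * ((16 : ℝ) ^ t) ^ (4 * t)))
      ≤ (n : ℝ) ^ (8 * t + 2) := by
    calc 2 * (X ^ (5 * (8 * t + 2)) * (n ^ (6 * t + 2) * ((16 : ℝ) ^ t) ^ (4 * t)))
        ≤ X ^ t * (X ^ (5 * (8 * t + 2)) * (n ^ (6 * t + 2) * (X ^ (4 * t)) ^ (4 * t))) := by
          gcongr
      _ = X ^ (t + 5 * (8 * t + 2)) * ((X ^ (16 * t)) ^ t * (n : ℝ) ^ (6 * t + 2)) := by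
          rw [← pow_mul, ← pow_mul, pow_add, show 4 * t * (4 * t) = 16 * t * t by ring]
          ring
      _ ≤ n * ((n : ℝ) ^ t * (n : ℝ) ^ (6 * t + 2)) := by
          gcongr
          · exact mono (by omega)
          · exact mono (by omega)
      _ = (n : ℝ) ^ (7 * t + 3) := by ring
      _ ≤ (n : ℝ) ^ (8 * t + 2) := by
          apply pow_le_pow_right₀ _ (by omega)
          exact le_trans (one_le_pow₀ hX1) hn.le
  have key2 : 2 * (X ^ (5 * (8 * t + 2)) * (n ^ (8 * t + 1) * (16 : ℝ) ^ t))
      < (n : ℝ) ^ (8 * t + 2) := by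
    calc 2 * (X ^ (5 * (8 * t + 2)) * (n ^ (8 * t + 1) * (16 : ℝ) ^ t))
        ≤ X ^ t * (X ^ (5 * (8 * t + 2)) * (n ^ (8 * t + 1) * X ^ (4 * t))) := by
          gcongr
      _ = X ^ (t + 5 * (8 * t + 2) + 4 * t) * (n : ℝ) ^ (8 * t + 1) := by
          rw [pow_add, pow_add]; ring
      _ < n * (n : ℝ) ^ (8 * t + 1) := by
          gcongr
          exact lt_of_le_of_lt (pow_le_pow_right₀ hX1 (by omega)) hn
      _ = (n : ℝ) ^ (8 * t + 2) := by ring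
  have hfin : X ^ (5 * (8 * t + 2)) * ((n : ℝ) ^ (6 * t + 2) * ((16 : ℝ) ^ t) ^ (4 * t)
      + n ^ (8 * t + 1) * (16 : ℝ) ^ t) < X ^ (5 * (8 * t + 2)) * (a : ℝ) ^ (8 * t + 2) := by
    have : (n : ℝ) ^ (8 * t + 2) ≤ X ^ (5 * (8 * t + 2)) * (a : ℝ) ^ (8 * t + 2) := by
      rw [pow_mul X, ← mul_pow]
      gcongr
    rw [mul_add]
    linarith
  have hfin2 := lt_of_mul_lt_mul_left hfin (by positivity)
  have hfin3 : n ^ (6 * t + 2) * (16 ^ t) ^ (4 * t) + n ^ (8 * t + 1) * 16 ^ t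
      < a ^ (8 * t + 2) := by exact_mod_cast hfin2
  have e1 : n ^ 2 * (n ^ t * n ^ t * ((16 ^ t) ^ (4 * t) * n ^ (4 * t)))
      = n ^ (6 * t + 2) * (16 ^ t) ^ (4 * t) := by
    rw [show 6 * t + 2 = 2 + t + t + 4 * t by ring, pow_add, pow_add, pow_add]
    generalize (16 ^ t) ^ (4 * t) = z
    ring
  have e2 : (n ^ (4 * t) * n ^ (4 * t)) * (16 ^ t * n) = n ^ (8 * t + 1) * 16 ^ t := by
    rw [show 8 * t + 1 = 4 * t + 4 * t + 1 by ring, pow_add, pow_add]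
    ring
  have e3 : (a * a) * (a ^ (4 * t) * a ^ (4 * t)) = a ^ (8 * t + 2) := by
    rw [show 8 * t + 2 = 4 * t + 4 * t + 2 by ring, pow_add, pow_add]
    ring
  rw [e1, e2, e3]
  exact hfin3

/-- There is an absolute constant `C > 0` such that for every `0 < ε < 1/2` and positive
integers `t, n` with `n > ε^{-Ct}`, every 2-colouring of `K_n` in which every vertex has at
least `εn` neighbours in each colour contains a `t`-locally-unavoidable pattern. -/
theorem stmt_1 :
    ∃ C : ℝ, 0 < C ∧
      ∀ (ε : ℝ) (t n : ℕ), 0 < ε → ε < 1 / 2 → 0 < t → 0 < n →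
        (n : ℝ) > ε ^ (-(C * t)) →
        ∀ c : Fin n → Fin n → Bool, (∀ u v, c u v = c v u) →
          (∀ v : Fin n, ∀ col : Bool,
            (((univ.filter fun u => u ≠ v ∧ c v u = col)).card : ℝ) ≥ ε * n) →
          HasLocallyUnavoidable c t := by
  refine ⟨60, by norm_num, ?_⟩
  intro ε t n hε hε2 ht hn0 hn c hc hdeg
  have hnpow : (ε⁻¹) ^ (60 * t) < (n : ℝ) := by
    rw [Real.rpow_neg hε.le] at hn
    have : ε ^ ((60 : ℝ) * t) = ε ^ (60 * t) := by
      rw [← Real.rpow_natCast]; push_cast; rfl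
    rw [this] at hn
    rw [inv_pow]
    exact hn
  have hnR : (0 : ℝ) < n := by exact_mod_cast hn0
  have hinv : 2 ≤ ε⁻¹ := by
    rw [le_inv_comm₀ (by norm_num) hε]; linarith
  have h5 : (ε⁻¹) ^ 5 ≤ (n : ℝ) :=
    (pow_le_pow_right₀ (by linarith) (by omega)).trans hnpow.le
  have h3 : 8 ≤ ε ^ 2 * n := by
    calc (8 : ℝ) = 2 ^ 3 := by norm_num
      _ ≤ (ε⁻¹) ^ 3 := by gcongr
      _ = ε ^ 2 * (ε⁻¹) ^ 5 := by field_simp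
      _ ≤ ε ^ 2 * n := by gcongr
  obtain ⟨a, ha⟩ : ∃ a : ℕ, a = ⌊ε ^ 2 * n / 4⌋₊ := ⟨_, rfl⟩
  have ha1 : (a : ℝ) ≤ ε ^ 2 * n / 4 := by
    rw [ha]; exact Nat.floor_le (by positivity)
  have ha2 : ε ^ 2 * n / 8 ≤ (a : ℝ) := by
    have := Nat.lt_floor_add_one (ε ^ 2 * n / 4)
    rw [← ha] at this
    linarith
  have ha3 : ε ^ 5 * n ≤ (a : ℝ) := by
    refine le_trans ?_ ha2
    have : ε ^ 3 ≤ (1 / 2) ^ 3 := by gcongr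
    calc ε ^ 5 * n = ε ^ 3 * (ε ^ 2 * n) := by ring
      _ ≤ (1 / 2) ^ 3 * (ε ^ 2 * n) := by gcongr
      _ = ε ^ 2 * n / 8 := by ring
  obtain ⟨G, hGc, hG⟩ := many_pairs c hc ε hε hε2 (by linarith) (fun v col => hdeg v col) a ha1
  have hnum := numeric ε t n a hε hε2 ht hnpow ha3
  obtain ⟨U, K, hU, hK, hUK⟩ := drc (nbh c false) (nbh c true) n t (4 * t) (16 ^ t) a
    (Fintype.card_fin n) G hG (lt_of_lt_of_le hnum (Nat.mul_le_mul_right _ hGc))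
  obtain ⟨S, hS, T, hT, hSc, hTc, mS, mT, mST⟩ := pair_mono c hc t U K hU hK
  obtain ⟨hY, hL⟩ := hUK S hS T hT hSc hTc
  obtain ⟨Y, hYs, L, hLs, hYc, hLc, mY, mL, mYL⟩ := pair_mono c hc t _ _ hY hL
  have f1 : ∀ u ∈ S, ∀ y ∈ Y, y ≠ u ∧ c u y = false := fun u hu y hy =>
    (Finset.mem_filter.1 (((mem_cmn _ _ _ _ _).1 (hYs hy)).1 u hu)).2
  have f2 : ∀ u ∈ T, ∀ y ∈ Y, y ≠ u ∧ c u y = true := fun u hu y hy =>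
    (Finset.mem_filter.1 (((mem_cmn _ _ _ _ _).1 (hYs hy)).2 u hu)).2
  have f3 : ∀ u ∈ S, ∀ y ∈ L, y ≠ u ∧ c u y = true := fun u hu y hy =>
    (Finset.mem_filter.1 (((mem_cmn _ _ _ _ _).1 (hLs hy)).1 u hu)).2
  have f4 : ∀ u ∈ T, ∀ y ∈ L, y ≠ u ∧ c u y = false := fun u hu y hy =>
    (Finset.mem_filter.1 (((mem_cmn _ _ _ _ _).1 (hLs hy)).2 u hu)).2
  obtain ⟨y0, hy0⟩ : Y.Nonempty := Finset.card_pos.1 (by omega)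
  obtain ⟨u0, hu0⟩ : S.Nonempty := Finset.card_pos.1 (by omega)
  refine finish c hc t S T Y L hSc hTc hYc hLc ?_ ?_ ?_ ?_ ?_ ?_ mS mT mY mL mST mYL
    (fun u hu v hv => (f1 u hu v hv).2) (fun u hu v hv => (f2 u hu v hv).2)
    (fun u hu v hv => (f3 u hu v hv).2) (fun u hu v hv => (f4 u hu v hv).2)
  · rw [Finset.disjoint_left]
    intro x hx hx'
    have h1 := (f1 x hx y0 hy0).2
    have h2 := (f2 x hx' y0 hy0).2
    rw [h1] at h2
    exact Bool.noConfusion h2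
  · rw [Finset.disjoint_left]
    exact fun x hx hx' => (f1 x hx x hx').1 rfl
  · rw [Finset.disjoint_left]
    exact fun x hx hx' => (f3 x hx x hx').1 rfl
  · rw [Finset.disjoint_left]
    exact fun x hx hx' => (f2 x hx x hx').1 rfl
  · rw [Finset.disjoint_left]
    exact fun x hx hx' => (f4 x hx x hx').1 rfl
  · rw [Finset.disjoint_left]
    intro x hx hx'
    have h1 := (f1 u0 hu0 x hx).2
    have h2 := (f3 u0 hu0 x hx').2
    rw [h1] at h2
    exact Bool.noConfusion h2
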